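/- For every τ in the upper half-plane ℍ: 2·(f₁(τ)² − f₂(τ)²)·η(2τ)⁴ = η(τ/2)⁴·f₁(τ)·f₂(τ). (Equivalently, 2f₁/f₂ − 2f₂/f₁ = (η(τ/2)/η(2τ))⁴.) -/

import Mathlib

open Complex

/-- `∑_{n∈ℤ} q^{n²}`, `q = e^{2πiτ}`. -/
noncomputable def thetaInt (τ : ℂ) : ℂ :=
  ∑' n : ℤ, Complex.exp (2 * (Real.pi : ℂ) * I * (n : ℂ) ^ 2 * τ)

/-- `∑_{n∈ℤ} q^{(n+1/2)²}`, `q = e^{2πiτ}`. -/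
noncomputable def thetaHalf (τ : ℂ) : ℂ :=
  ∑' n : ℤ, Complex.exp (2 * (Real.pi : ℂ) * I * ((n : ℂ) + 1 / 2) ^ 2 * τ)

/-- The Dedekind eta function `η(τ) = e^{πiτ/12} ∏_{n≥1}(1 − e^{2πinτ})`. -/
noncomputable def dedekindEta (τ : ℂ) : ℂ :=
  Complex.exp ((Real.pi : ℂ) * I * τ / 12) *
    ∏' n : ℕ, (1 - Complex.exp (2 * (Real.pi : ℂ) * I * ((n : ℂ) + 1) * τ))

/-- `f₁ = (∑_{n∈ℤ} q^{n²})/η`. -/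
noncomputable def fOne (τ : ℂ) : ℂ := thetaInt τ / dedekindEta τ

/-- `f₂ = (∑_{n∈ℤ} q^{(n+1/2)²})/η`. -/
noncomputable def fTwo (τ : ℂ) : ℂ := thetaHalf τ / dedekindEta τ


/-- Gaussian binomial. -/
noncomputable def gB (q : ℂ) : ℕ → ℕ → ℂ
  | _, 0 => 1
  | 0, _ + 1 => 0
  | M + 1, j + 1 => gB q M j + q ^ (j + 1) * gB q M (j + 1)

lemma gB_zero_right (q : ℂ) (M : ℕ) : gB q M 0 = 1 := by cases M <;> rfl

lemma gB_eq_zero (q : ℂ) (M : ℕ) : ∀ j, M < j → gB q M j = 0 := by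
  induction M with
  | zero => intro j hj; obtain ⟨k, rfl⟩ := Nat.exists_eq_succ_of_ne_zero (by omega : j ≠ 0); rfl
  | succ M ih =>
    intro j hj
    obtain ⟨k, rfl⟩ := Nat.exists_eq_succ_of_ne_zero (by omega : j ≠ 0)
    show gB q M k + q ^ (k + 1) * gB q M (k + 1) = 0
    rw [ih k (by omega), ih (k + 1) (by omega)]; simp

noncomputable def qP (q : ℂ) (n : ℕ) : ℂ := ∏ k ∈ Finset.range n, (1 - q ^ (k + 1))

lemma qP_succ (q : ℂ) (n : ℕ) : qP q (n + 1) = qP q n * (1 - q ^ (n + 1)) :=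
  Finset.prod_range_succ _ _

lemma gB_mul (q : ℂ) (M : ℕ) : ∀ j k, j + k = M → gB q M j * qP q j * qP q k = qP q M := by
  induction M with
  | zero =>
    intro j k h
    obtain ⟨rfl, rfl⟩ : j = 0 ∧ k = 0 := by omega
    simp [gB_zero_right, qP]
  | succ M ih =>
    intro j k h
    rcases j with _ | j
    · obtain rfl : k = M + 1 := by omega
      simp [gB_zero_right, qP]
    · show (gB q M j + q ^ (j + 1) * gB q M (j + 1)) * _ * _ = _
      have h1 := ih j k (by omega)
      rcases k with _ | k
      · obtain rfl : j = M := by omega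
        rw [gB_eq_zero q j (j + 1) (by omega), qP_succ]
        linear_combination (1 - q ^ (j + 1)) * h1
      · have h2 := ih (j + 1) k (by omega)
        obtain rfl : M = j + 1 + k := by omega
        simp only [qP_succ] at h1 h2 ⊢
        have e : q ^ (j + 1 + k + 1) = q ^ (j + 1) * q ^ (k + 1) := by ring
        rw [e]
        linear_combination (1 - q ^ (j + 1)) * h1 + q ^ (j + 1) * (1 - q ^ (k + 1)) * h2

lemma qbinom (q : ℂ) (M : ℕ) : ∀ y : ℂ, ∏ k ∈ Finset.range M, (1 + q ^ k * y) =
    ∑ j ∈ Finset.range (M + 1), gB q M j * q ^ (j.choose 2) * y ^ j := by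
  induction M with
  | zero => intro y; simp [gB_zero_right]
  | succ M ih =>
    intro y
    have e : ∏ k ∈ Finset.range M, (1 + q ^ (k + 1) * y) =
        ∏ k ∈ Finset.range M, (1 + q ^ k * (q * y)) :=
      Finset.prod_congr rfl fun k _ => by ring
    rw [Finset.prod_range_succ', e, ih, Finset.sum_range_succ' _ (M + 1)]
    have e2 : ∀ j, gB q (M + 1) (j + 1) * q ^ ((j + 1).choose 2) * y ^ (j + 1) =
        gB q M j * q ^ (j.choose 2) * (q * y) ^ j * y +
        gB q M (j + 1) * q ^ ((j + 1).choose 2) * (q * y) ^ (j + 1) := by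
      intro j
      have : (j + 1).choose 2 = j.choose 2 + j := by
        rw [Nat.choose_succ_succ' j 1, Nat.choose_one_right]; ring
      rw [this]
      show (gB q M j + q ^ (j + 1) * gB q M (j + 1)) * _ * _ = _
      ring
    simp only [e2]
    rw [Finset.sum_add_distrib, ← Finset.sum_mul,
      Finset.sum_range_succ (fun j => gB q M (j + 1) * q ^ ((j + 1).choose 2) * (q * y) ^ (j + 1)) M,
      gB_eq_zero q M (M + 1) (by omega)]
    have e3 := Finset.sum_range_succ' (fun j => gB q M j * q ^ (j.choose 2) * (q * y) ^ j) M
    simp only [gB_zero_right] at e3 ⊢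
    simp only [pow_zero, Nat.choose_zero_succ] at e3 ⊢
    linear_combination e3

lemma jtp_fin (x z : ℂ) (hx : x ≠ 0) (hz : z ≠ 0) (N : ℕ) :
    ∏ k ∈ Finset.range N, ((1 + x ^ (2 * k + 1) * z) * (1 + x ^ (2 * k + 1) * z⁻¹)) =
    ∑ j ∈ Finset.range (2 * N + 1),
      gB (x ^ 2) (2 * N) j * (x ^ (((j : ℤ) - N) ^ 2) * z ^ ((j : ℤ) - N)) := by
  have h := qbinom (x ^ 2) (2 * N) (x * z / x ^ (2 * N))
  have hp : ∏ k ∈ Finset.range (2 * N), (1 + (x ^ 2) ^ k * (x * z / x ^ (2 * N))) =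
      z ^ N / x ^ (N ^ 2) *
      ∏ k ∈ Finset.range N, ((1 + x ^ (2 * k + 1) * z) * (1 + x ^ (2 * k + 1) * z⁻¹)) := by
    rw [two_mul, Finset.prod_range_add, ← Finset.prod_range_reflect, Finset.prod_mul_distrib]
    have e1 : ∏ j ∈ Finset.range N, (1 + (x ^ 2) ^ (N - 1 - j) * (x * z / x ^ (N + N))) =
        ∏ j ∈ Finset.range N, ((z / x ^ (2 * j + 1)) * (1 + x ^ (2 * j + 1) * z⁻¹)) := by
      refine Finset.prod_congr rfl fun j hj => ?_
      have hj := Finset.mem_range.1 hj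
      obtain ⟨i, rfl⟩ : ∃ i, N = j + 1 + i := ⟨N - (j + 1), by omega⟩
      have : j + 1 + i - 1 - j = i := by omega
      rw [this]
      field_simp
      ring
    have e2 : ∏ j ∈ Finset.range N, (1 + (x ^ 2) ^ (N + j) * (x * z / x ^ (N + N))) =
        ∏ j ∈ Finset.range N, (1 + x ^ (2 * j + 1) * z) := by
      refine Finset.prod_congr rfl fun j hj => ?_
      field_simp
      ring
    have e3 : ∏ j ∈ Finset.range N, (z / x ^ (2 * j + 1)) = z ^ N / x ^ (N ^ 2) := by
      clear * - hx hz
      induction N with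
      | zero => simp
      | succ N ih => rw [Finset.prod_range_succ, ih]; field_simp; ring
    rw [e1, e2, Finset.prod_mul_distrib, e3]
    ring
  rw [hp] at h
  have hne : z ^ N / x ^ (N ^ 2) ≠ 0 := by positivity
  apply mul_left_cancel₀ hne
  rw [h, Finset.mul_sum]
  refine Finset.sum_congr rfl fun j _ => ?_
  have e4 : (x ^ 2) ^ (j.choose 2) * x ^ j = x ^ (j ^ 2) := by
    rw [← pow_mul, ← pow_add]
    congr 1
    rw [Nat.choose_two_right, Nat.mul_div_cancel' (Nat.even_mul_pred_self j).two_dvd]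
    cases j <;> simp; ring
  have e5 : x ^ (((j : ℤ) - N) ^ 2) = x ^ (j ^ 2) * x ^ (N ^ 2) / x ^ (2 * N * j) := by
    rw [show ((j : ℤ) - N) ^ 2 = ((j ^ 2 : ℕ) : ℤ) + ((N ^ 2 : ℕ) : ℤ) - ((2 * N * j : ℕ) : ℤ) by
      push_cast; ring, zpow_sub₀ hx, zpow_add₀ hx]
    simp only [zpow_natCast]
  rw [e5, zpow_sub₀ hz, ← e4]
  simp only [zpow_natCast]
  rw [div_pow, mul_pow, ← pow_mul x (2 * N) j]
  field_simp

noncomputable def PP (q : ℂ) : ℂ := ∏' n : ℕ, (1 - q ^ (n + 1))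

lemma one_sub_pow_ne {q : ℂ} (hq : ‖q‖ < 1) (n : ℕ) : 1 - q ^ (n + 1) ≠ 0 := by
  intro h
  have h1 : ‖q ^ (n + 1)‖ < 1 := by
    rw [norm_pow]; exact pow_lt_one₀ (norm_nonneg _) hq (by omega)
  rw [← sub_eq_zero.1 h] at h1
  simp at h1

lemma PP_ne {q : ℂ} (hq : ‖q‖ < 1) : PP q ≠ 0 := by
  refine tprod_one_add_ne_zero_of_summable (f := fun n : ℕ ↦ -q ^ (n + 1)) ?_ ?_
  · exact fun i ↦ by simpa [← sub_eq_add_neg] using one_sub_pow_ne hq i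
  · simpa using (summable_nat_add_iff 1).mpr (summable_geometric_of_lt_one (norm_nonneg _) hq)

lemma qP_tendsto {q : ℂ} (hq : ‖q‖ < 1) :
    Filter.Tendsto (qP q) Filter.atTop (nhds (PP q)) :=
  (ModularForm.multipliable_one_sub_pow hq).tendsto_prod_tprod_nat

lemma qP_ne {q : ℂ} (hq : ‖q‖ < 1) (n : ℕ) : qP q n ≠ 0 :=
  Finset.prod_ne_zero_iff.2 fun k _ => one_sub_pow_ne hq k

lemma gB_bound {q : ℂ} (hq : ‖q‖ < 1) : ∃ K : ℝ, ∀ M j, ‖gB q M j‖ ≤ K := by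
  obtain ⟨C, hC⟩ := (qP_tendsto hq).norm.bddAbove_range
  obtain ⟨D, hD⟩ := ((qP_tendsto hq).inv₀ (PP_ne hq)).norm.bddAbove_range
  have hC' : ∀ n, ‖qP q n‖ ≤ C := fun n => hC ⟨n, rfl⟩
  have hD' : ∀ n, ‖(qP q n)⁻¹‖ ≤ D := fun n => hD ⟨n, rfl⟩
  have hC0 : 0 ≤ C := (norm_nonneg _).trans (hC' 0)
  have hD0 : 0 ≤ D := (norm_nonneg _).trans (hD' 0)
  refine ⟨C * D * D, fun M j => ?_⟩
  by_cases h : M < j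
  · rw [gB_eq_zero q M j h, norm_zero]; positivity
  · have h1 := gB_mul q M j (M - j) (by omega)
    have : gB q M j = qP q M * (qP q j)⁻¹ * (qP q (M - j))⁻¹ := by
      rw [← h1]
      have := qP_ne hq j
      have := qP_ne hq (M - j)
      field_simp
    rw [this, norm_mul, norm_mul]
    gcongr
    · exact hC' _
    · exact hD' _
    · exact hD' _

lemma gB_lim {q : ℂ} (hq : ‖q‖ < 1) (n : ℤ) :
    Filter.Tendsto (fun N : ℕ => gB q (2 * N) (n + N).toNat) Filter.atTop (nhds (PP q)⁻¹) := by
  have hN : Filter.Tendsto (fun N : ℕ => 2 * N) Filter.atTop Filter.atTop :=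
    Filter.tendsto_atTop_mono (fun N => by simp only [id]; omega) Filter.tendsto_id
  have h1 : Filter.Tendsto (fun N : ℕ => (n + N).toNat) Filter.atTop Filter.atTop := by
    rw [Filter.tendsto_atTop]
    intro b
    filter_upwards [Filter.eventually_ge_atTop (b + n.natAbs)] with N hN
    omega
  have h2 : Filter.Tendsto (fun N : ℕ => (N - n : ℤ).toNat) Filter.atTop Filter.atTop := by
    rw [Filter.tendsto_atTop]
    intro b
    filter_upwards [Filter.eventually_ge_atTop (b + n.natAbs)] with N hN
    omega
  have h := qP_tendsto hq
  have h3 := ((h.comp hN).mul ((h.comp h1).inv₀ (PP_ne hq))).mul ((h.comp h2).inv₀ (PP_ne hq))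
  have e : PP q * (PP q)⁻¹ * (PP q)⁻¹ = (PP q)⁻¹ := by
    rw [mul_inv_cancel₀ (PP_ne hq), one_mul]
  rw [e] at h3
  refine h3.congr' ?_
  filter_upwards [Filter.eventually_ge_atTop n.natAbs] with N hN
  have h4 := gB_mul q (2 * N) (n + N).toNat (N - n : ℤ).toNat (by omega)
  simp only [Function.comp_apply]
  rw [← h4]
  have := qP_ne hq (n + N).toNat
  have := qP_ne hq (N - n : ℤ).toNat
  field_simp

lemma mulp {x z : ℂ} (hx : ‖x‖ < 1) (a b : ℕ) (ha : a ≠ 0) : 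
    Multipliable fun k : ℕ => (1 + x ^ (a * k + b) * z) := by
  apply multipliable_one_add_of_summable
  have : ∀ k, ‖x ^ (a * k + b) * z‖ = (‖x‖ ^ a) ^ k * (‖x‖ ^ b * ‖z‖) := by
    intro k; rw [norm_mul, norm_pow]; ring
  simp only [this]
  exact (summable_geometric_of_lt_one (by positivity)
    (pow_lt_one₀ (norm_nonneg _) hx ha)).mul_right _

lemma mulp' {x : ℂ} (hx : ‖x‖ < 1) (z : ℂ) (a b : ℕ) (ha : a ≠ 0) (f : ℕ → ℂ)
    (hf : ∀ k, f k = 1 + x ^ (a * k + b) * z) : Multipliable f := by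
  rw [show f = fun k => 1 + x ^ (a * k + b) * z from funext hf]
  exact mulp hx a b ha

lemma jtp (x z : ℂ) (hx : x ≠ 0) (hz : z ≠ 0) (hx1 : ‖x‖ < 1)
    (hs : Summable fun n : ℤ => x ^ (n ^ 2) * z ^ n) :
    ∑' n : ℤ, x ^ (n ^ 2) * z ^ n =
      PP (x ^ 2) * ((∏' k : ℕ, (1 + x ^ (2 * k + 1) * z)) * ∏' k : ℕ, (1 + x ^ (2 * k + 1) * z⁻¹)) := by
  have hq : ‖x ^ 2‖ < 1 := by rw [norm_pow]; exact pow_lt_one₀ (norm_nonneg _) hx1 (by omega)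
  obtain ⟨K, hK⟩ := gB_bound hq
  have hK0 : 0 ≤ K := (norm_nonneg _).trans (hK 0 0)
  let f : ℕ → ℤ → ℂ := fun N n => if n ∈ Finset.Icc (-N : ℤ) N then
    gB (x ^ 2) (2 * N) (n + N).toNat * (x ^ (n ^ 2) * z ^ n) else 0
  have hf : ∀ N : ℕ, ∑' n, f N n = ∏ k ∈ Finset.range N,
      ((1 + x ^ (2 * k + 1) * z) * (1 + x ^ (2 * k + 1) * z⁻¹)) := by
    intro N
    rw [jtp_fin x z hx hz, tsum_eq_sum (s := Finset.Icc (-N : ℤ) N)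
      (fun n hn => by simp only [f]; rw [if_neg hn])]
    symm
    refine Finset.sum_bij (fun (j : ℕ) _ => (j : ℤ) - N) ?_ ?_ ?_ ?_
    · intro j hj; simp at hj ⊢; omega
    · intro j _ i _ h; simp at h; exact h
    · intro n hn
      simp at hn
      exact ⟨(n + N).toNat, by simp; omega, by omega⟩
    · intro j hj
      simp only [f]
      rw [if_pos (by simp at hj ⊢; omega)]
      congr 3
      omega
  have ht : Filter.Tendsto (fun N => ∑' n, f N n) Filter.atTop
      (nhds (∑' n : ℤ, (PP (x ^ 2))⁻¹ * (x ^ (n ^ 2) * z ^ n))) := by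
    refine tendsto_tsum_of_dominated_convergence (hs.norm.mul_left K) ?_ ?_
    · intro n
      refine ((gB_lim hq n).mul_const _).congr' ?_
      filter_upwards [Filter.eventually_ge_atTop n.natAbs] with N hN
      simp only [f]
      rw [if_pos (by simp; omega)]
    · refine Filter.Eventually.of_forall fun N n => ?_
      simp only [f]
      split_ifs
      · rw [norm_mul]; gcongr; exact hK _ _
      · rw [norm_zero]; positivity
  have ht2 := ((mulp (z := z) hx1 2 1 two_ne_zero).tendsto_prod_tprod_nat).mul
    ((mulp (z := z⁻¹) hx1 2 1 two_ne_zero).tendsto_prod_tprod_nat)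
  simp only [hf, Finset.prod_mul_distrib] at ht
  have := tendsto_nhds_unique ht ht2
  rw [← this, tsum_mul_left, mul_inv_cancel_left₀ (PP_ne hq)]

lemma tsum_int_even_odd (f : ℤ → ℂ) (hf : Summable f) :
    ∑' n, f n = ∑' k, f (2 * k) + ∑' k, f (2 * k + 1) := by
  have i1 : Function.Injective (fun k : ℤ => 2 * k) := fun a b h => by simpa using h
  have i2 : Function.Injective (fun k : ℤ => 2 * k + 1) := fun a b h => by simpa using h
  have h1 := (hf.comp_injective i1).hasSum
  have h2 := (hf.comp_injective i2).hasSum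
  have h1' := i1.hasSum_range_iff.2 h1
  have h2' := i2.hasSum_range_iff.2 h2
  refine (HasSum.add_isCompl ?_ h1' h2').tsum_eq
  have e1 : Set.range (fun k : ℤ => 2 * k) = {n : ℤ | Even n} := by
    ext n; simp [even_iff_exists_two_mul]
  have e2 : Set.range (fun k : ℤ => 2 * k + 1) = {n : ℤ | Odd n} := by
    ext n; simp [Odd]
  rw [e1, e2]
  exact Int.isCompl_even_odd

lemma norm_exp_lt {τ : ℂ} (hτ : 0 < τ.im) : ‖cexp (Real.pi * I * τ)‖ < 1 := by
  rw [Complex.norm_exp, Real.exp_lt_one_iff]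
  simp
  positivity

lemma summ {τ : ℂ} (hτ : 0 < τ.im) (w x z : ℂ) (hx : x = cexp (Real.pi * I * τ))
    (hz : z = cexp (2 * Real.pi * I * w)) : Summable fun n : ℤ => x ^ (n ^ 2) * z ^ n := by
  refine ((summable_jacobiTheta₂_term_iff w τ).2 hτ).congr fun n => ?_
  rw [hx, hz, ← Complex.exp_int_mul, ← Complex.exp_int_mul, ← Complex.exp_add, jacobiTheta₂_term]
  congr 1
  push_cast
  ring

lemma PP_split {x : ℂ} (hx : ‖x‖ < 1) :
    PP x = (∏' k : ℕ, (1 + x ^ (2 * k + 1) * (-1))) * PP (x ^ 2) := by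
  have h := tprod_even_mul_odd (f := fun n => 1 + x ^ (n + 1) * (-1))
    (mulp' hx (-1) 2 1 two_ne_zero _ fun k => by ring)
    (mulp' hx (-1) 2 2 two_ne_zero _ fun k => by ring)
  rw [show PP x = ∏' n : ℕ, (1 + x ^ (n + 1) * (-1)) from tprod_congr fun n => by ring, ← h]
  congr 1
  exact tprod_congr fun n => by ring

lemma E_split {x : ℂ} (hx : ‖x‖ < 1) :
    (∏' k : ℕ, (1 + x ^ (2 * k + 1) * 1)) * (∏' k : ℕ, (1 + x ^ (2 * k + 2) * 1)) =
      ∏' k : ℕ, (1 + x ^ (1 * k + 1) * 1) := by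
  have h := tprod_even_mul_odd (f := fun n => 1 + x ^ (1 * n + 1) * 1)
    (by simpa using mulp (z := 1) hx 2 1 two_ne_zero)
    (by simpa using mulp (z := 1) hx 2 2 two_ne_zero)
  rw [← h]
  congr 1 <;> exact tprod_congr fun n => by ring

lemma PP_E {x : ℂ} (hx : ‖x‖ < 1) :
    PP x * (∏' k : ℕ, (1 + x ^ (1 * k + 1) * 1)) = PP (x ^ 2) := by
  rw [PP, ← (ModularForm.multipliable_one_sub_pow hx).tprod_mul (mulp hx 1 1 one_ne_zero)]
  exact tprod_congr fun n => by ring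

lemma O_mul {r : ℂ} (hr : ‖r‖ < 1) :
    (∏' k : ℕ, (1 + r ^ (2 * k + 1) * 1)) * (∏' k : ℕ, (1 + r ^ (2 * k + 1) * (-1))) =
      ∏' k : ℕ, (1 + (r ^ 2) ^ (2 * k + 1) * (-1)) := by
  rw [← (mulp hr 2 1 two_ne_zero).tprod_mul (mulp hr 2 1 two_ne_zero)]
  exact tprod_congr fun n => by ring

lemma Ev_shift {x : ℂ} (hx0 : x ≠ 0) (hx : ‖x‖ < 1) :
    (∏' k : ℕ, (1 + x ^ (2 * k + 1) * x)) * (∏' k : ℕ, (1 + x ^ (2 * k + 1) * x⁻¹)) =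
      2 * (∏' k : ℕ, (1 + x ^ (2 * k + 2) * 1)) ^ 2 := by
  have h1 : ∏' k : ℕ, (1 + x ^ (2 * k + 1) * x) = ∏' k : ℕ, (1 + x ^ (2 * k + 2) * 1) :=
    tprod_congr fun n => by ring
  have h2 : ∏' k : ℕ, (1 + x ^ (2 * k + 1) * x⁻¹) =
      2 * ∏' k : ℕ, (1 + x ^ (2 * k + 2) * 1) := by
    have e : ∀ k, 1 + x ^ (2 * k + 1) * x⁻¹ = 1 + x ^ (2 * k) * 1 := fun k => by
      rw [pow_succ]; field_simp
    simp only [e]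
    rw [tprod_eq_zero_mul' (f := fun k : ℕ => 1 + x ^ (2 * k) * 1)
      (mulp' hx 1 2 2 two_ne_zero _ fun k => by ring)]
    congr 1
    norm_num
  rw [h1, h2]; ring

lemma eta_eq (τ : ℂ) : dedekindEta τ =
    cexp ((Real.pi : ℂ) * I * τ / 12) * PP (cexp (2 * Real.pi * I * τ)) := by
  rw [dedekindEta, PP]
  congr 1
  refine tprod_congr fun n => ?_
  rw [← Complex.exp_nat_mul]
  congr 2
  push_cast
  ring

/-- for every `τ ∈ ℍ`,
`2·(f₁(τ)² − f₂(τ)²)·η(2τ)⁴ = η(τ/2)⁴·f₁(τ)·f₂(τ)`, i.e.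
`2f₁/f₂ − 2f₂/f₁ = (η(τ/2)/η(2τ))⁴`. -/
theorem stmt_8 (τ : ℂ) (hτ : 0 < τ.im) :
    2 * (fOne τ ^ 2 - fTwo τ ^ 2) * dedekindEta (2 * τ) ^ 4 =
      dedekindEta (τ / 2) ^ 4 * fOne τ * fTwo τ := by
  have him : 0 < (τ / 2).im := by simpa using hτ
  have him2 : 0 < (2 * τ).im := by simpa using hτ
  obtain ⟨r, hr⟩ : ∃ r, r = cexp (Real.pi * I * (τ / 2)) := ⟨_, rfl⟩
  have hr0 : r ≠ 0 := by rw [hr]; exact Complex.exp_ne_zero _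
  have hr1 : ‖r‖ < 1 := by rw [hr]; exact norm_exp_lt him
  have hrk : ∀ k : ℕ, k ≠ 0 → ‖r ^ k‖ < 1 := fun k hk => by
    rw [norm_pow]; exact pow_lt_one₀ (norm_nonneg _) hr1 hk
  have hx : r ^ 4 = cexp (Real.pi * I * (2 * τ)) := by
    rw [hr, ← Complex.exp_nat_mul]; congr 1; push_cast; ring
  -- summability
  have s1 := summ him 0 r 1 hr (by simp)
  have s2 := summ him (1 / 2) r (-1) hr (by
    rw [show 2 * (Real.pi : ℂ) * I * (1 / 2) = Real.pi * I by ring, Complex.exp_pi_mul_I])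
  have s3 := summ him2 0 (r ^ 4) 1 hx (by simp)
  have s4 := summ him2 τ (r ^ 4) (r ^ 4) hx (by rw [hx]; congr 1; ring)
  -- theta series
  have hA : thetaInt τ = ∑' n : ℤ, (r ^ 4) ^ (n ^ 2) * 1 ^ n := by
    refine tsum_congr fun n => ?_
    rw [hx, one_zpow, mul_one, ← Complex.exp_int_mul]
    congr 1; push_cast; ring
  have hB : thetaHalf τ = r * ∑' n : ℤ, (r ^ 4) ^ (n ^ 2) * (r ^ 4) ^ n := by
    rw [← tsum_mul_left]
    refine tsum_congr fun n => ?_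
    rw [hx, ← Complex.exp_int_mul, ← Complex.exp_int_mul, hr, ← Complex.exp_add, ← Complex.exp_add]
    congr 1; push_cast; ring
  have hp : thetaInt τ + thetaHalf τ = ∑' n : ℤ, r ^ (n ^ 2) * 1 ^ n := by
    rw [tsum_int_even_odd _ s1, hA, hB, ← tsum_mul_left]
    congr 1 <;> refine tsum_congr fun n => ?_
    · rw [one_zpow, one_zpow, ← zpow_natCast, ← zpow_mul]
      congr 2; push_cast; ring
    · rw [one_zpow, mul_one, ← zpow_natCast, ← zpow_mul, ← zpow_mul, ← zpow_add₀ hr0,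
        ← zpow_one_add₀ hr0]
      congr 1; push_cast; ring
  have hm : thetaInt τ - thetaHalf τ = ∑' n : ℤ, r ^ (n ^ 2) * (-1) ^ n := by
    rw [tsum_int_even_odd _ s2, hA, hB, ← tsum_mul_left, sub_eq_add_neg, ← tsum_neg]
    congr 1 <;> refine tsum_congr fun n => ?_
    · rw [one_zpow, (even_two_mul n).neg_one_zpow, ← zpow_natCast, ← zpow_mul]
      congr 2; push_cast; ring
    · rw [(odd_two_mul_add_one n).neg_one_zpow, mul_neg_one, ← zpow_natCast, ← zpow_mul,
        ← zpow_mul, ← zpow_add₀ hr0, ← zpow_one_add₀ hr0]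
      congr 2; push_cast; ring
  rw [jtp r 1 hr0 one_ne_zero hr1 s1, inv_one] at hp
  rw [jtp r (-1) hr0 (by norm_num) hr1 s2, inv_neg_one] at hm
  have hx0 : r ^ 4 ≠ 0 := pow_ne_zero _ hr0
  have hx1 := hrk 4 (by norm_num)
  rw [jtp (r ^ 4) 1 hx0 one_ne_zero hx1 s3, inv_one] at hA
  rw [jtp (r ^ 4) (r ^ 4) hx0 hx0 hx1 s4, Ev_shift hx0 hx1] at hB
  have k1 := O_mul hr1
  have k2 := PP_split (hrk 2 (by norm_num))
  have k3 := E_split hx1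
  have k4 := PP_E hx1
  rw [show (r ^ 2) ^ 2 = r ^ 4 by ring] at k2
  have hE2 : dedekindEta (2 * τ) ^ 4 =
      cexp ((Real.pi : ℂ) * I * (τ / 2) / 12) ^ 4 * r * PP ((r ^ 4) ^ 2) ^ 4 := by
    rw [eta_eq, mul_pow]
    congr 1
    · rw [hr, ← Complex.exp_nat_mul, ← Complex.exp_nat_mul, ← Complex.exp_add]
      congr 1; push_cast; ring
    · congr 2
      rw [hx, ← Complex.exp_nat_mul]
      congr 1; push_cast; ring
  have hE1 : dedekindEta (τ / 2) ^ 4 =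
      cexp ((Real.pi : ℂ) * I * (τ / 2) / 12) ^ 4 * PP (r ^ 2) ^ 4 := by
    rw [eta_eq, mul_pow]
    congr 3
    rw [hr, ← Complex.exp_nat_mul]
    congr 1; push_cast; ring
  rw [hE2, hE1, fOne, fTwo]
  generalize thetaInt τ = A at *
  generalize thetaHalf τ = B at *
  generalize dedekindEta τ = e at *
  generalize cexp ((Real.pi : ℂ) * I * (τ / 2) / 12) = c at *
  generalize (∏' k : ℕ, (1 + r ^ (2 * k + 1) * 1)) = U at *
  generalize (∏' k : ℕ, (1 + r ^ (2 * k + 1) * (-1))) = V at *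
  generalize (∏' k : ℕ, (1 + (r ^ 2) ^ (2 * k + 1) * (-1))) = O at *
  generalize (∏' k : ℕ, (1 + (r ^ 4) ^ (2 * k + 1) * 1)) = W at *
  generalize (∏' k : ℕ, (1 + (r ^ 4) ^ (2 * k + 2) * 1)) = Y at *
  generalize (∏' k : ℕ, (1 + (r ^ 4) ^ (1 * k + 1) * 1)) = Z at *
  generalize PP ((r ^ 4) ^ 2) = P8 at *
  generalize PP (r ^ 4) = P4 at *
  generalize PP (r ^ 2) = P2 at *
  have hD : A ^ 2 - B ^ 2 = P2 ^ 2 * O ^ 2 := by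
    rw [← k1]
    linear_combination (A - B) * hp + P2 * (U * U) * hm
  have hAB : A * B = 2 * r * P8 ^ 2 * Z ^ 2 := by
    rw [← k3, hA, hB]; ring
  have key : O * P8 = P2 * Z := by rw [← k4, k2]; ring
  have main : 2 * (A ^ 2 - B ^ 2) * (r * P8 ^ 4) = P2 ^ 4 * (A * B) := by
    rw [hD, hAB]
    linear_combination 2 * r * P2 ^ 2 * P8 ^ 2 * (O * P8 + P2 * Z) * key
  linear_combination c ^ 4 / e ^ 2 * main
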